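/- arXiv:2505.15940 — 2 statements merged into one kernel-verified Lean document; each statement's English description precedes it below -/
import Mathlib

section
/- Consider the under-constrained counting chain with parameter q ∈ (0, 1/3). Let (X^{(r)})_{r=−1}^{R} be the comparison chain with X^{(−1)} = M₁^{(−1)}, X^{(0)} = M₁^{(0)}, and X^{(r)} | X^{(r−1)} ~ Poisson(X^{(r−1)}) for r = 1,…,R. Then there exists a function E = E(n) with E(n) → 1 as n → ∞ such that for all integers x^{(−1)}, x^{(0)}, …, x^{(R)} ∈ {0, 1, …, ⌊n^q·log n⌋}: P( M₁^{(r)} = x^{(r)} for all r ∈ {1,…,R} | M₁^{(−1)} = x^{(−1)}, M₁^{(0)} = x^{(0)} ) ≥ E(n) · P( X^{(r)} = x^{(r)} for all r ∈ {1,…,R} | X^{(−1)} = x^{(−1)}, X^{(0)} = x^{(0)} ). -/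
open Filter Topology MeasureTheory ENNReal

noncomputable section

/-- `p₀(a,b) = b(b−1)/(4a(a−1))`. -/
def prob0 (a b : ℕ) : ℝ := ((b : ℝ) * ((b : ℝ) - 1)) / (4 * (a : ℝ) * ((a : ℝ) - 1))

/-- `p₁(a,b) = (a−b)b/(a(a−1))`. -/
def prob1 (a b : ℕ) : ℝ := (((a : ℝ) - (b : ℝ)) * (b : ℝ)) / ((a : ℝ) * ((a : ℝ) - 1))

/-- `p₂(a,b) = (a−b)(a−b−1)/(a(a−1))`. -/
def prob2 (a b : ℕ) : ℝ :=
  (((a : ℝ) - (b : ℝ)) * ((a : ℝ) - (b : ℝ) - 1)) / ((a : ℝ) * ((a : ℝ) - 1))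

/-- `p⋆(a,b) = 1 − p₀ − p₁ − p₂`. -/
def probStar (a b : ℕ) : ℝ := 1 - prob0 a b - prob1 a b - prob2 a b

/-- The probability vector `p(a,b) = (p₀,p₁,p₂,p⋆)(a,b)`. -/
def pvec (a b : ℕ) : Fin 4 → ℝ := ![prob0 a b, prob1 a b, prob2 a b, probStar a b]

/-- The multinomial pmf with `N` trials, four categories. -/
def multinomialPMF (N : ℕ) (p : Fin 4 → ℝ) (k : Fin 4 → ℕ) : ℝ :=
  if (∑ i, k i) = N then
    (N.factorial : ℝ) / (∏ i, ((k i).factorial : ℝ)) * ∏ i, (p i) ^ (k i)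
  else 0

/-- `R = ⌊n^{1−2q}/log³ n⌋`. -/
def RparU (n : ℕ) (q : ℝ) : ℕ := ⌊(n : ℝ) ^ (1 - 2 * q) / (Real.log n) ^ 3⌋₊

/-- `US a b h k = S^{(k−1)}`, where `S^{(−1)} = M₁^{(−1)} = a`, `S^{(0)} = a + b`
(`M₁^{(0)} = b`) and `S^{(r)} = S^{(r−1)} + M₁^{(r)}` with `M₁^{(r)} = h r` for `r ≥ 1`. -/
def US (a b : ℕ) (h : ℕ → ℕ) : ℕ → ℕ
  | 0 => a
  | k + 1 => US a b h k + (if k = 0 then b else h k)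

/-- `M₁^{(r−1)}` seen from round `r ≥ 1`. -/
def UM1prev (b : ℕ) (h : ℕ → ℕ) (r : ℕ) : ℕ := if r ≤ 1 then b else h (r - 1)

/-- The under-constrained counting chain: `A = M₁^{(−1)}`, `B = M₁^{(0)}`, and for rounds
`r ∈ {1,…,R}`, conditionally on all variables of rounds `< r`, the vector
`M ω r = (M₀,M₁,M₂,M⋆)^{(r)}` is Multinomial with `n − S^{(r−1)}` trials and probability
vector `p(n − S^{(r−2)}, M₁^{(r−1)})`. -/
def IsUnderChain (n : ℕ) (q : ℝ) {Ω : Type*} [MeasurableSpace Ω] (P : Measure Ω)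
    (A B : Ω → ℕ) (M : Ω → ℕ → Fin 4 → ℕ) : Prop :=
  Measurable A ∧ Measurable B ∧ (∀ r, Measurable (fun ω => M ω r)) ∧
  (∀ ω, A ω ≤ n) ∧ (∀ ω, B ω ≤ n) ∧
  ∀ r : ℕ, 1 ≤ r → r ≤ RparU n q → ∀ a b : ℕ, ∀ h : ℕ → Fin 4 → ℕ, ∀ v : Fin 4 → ℕ,
    P {ω | A ω = a ∧ B ω = b ∧ (∀ s, 1 ≤ s → s < r → M ω s = h s) ∧ M ω r = v}
      = ENNReal.ofReal
          (multinomialPMF (n - US a b (fun s => h s 1) r)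
            (pvec (n - US a b (fun s => h s 1) (r - 1))
              (UM1prev b (fun s => h s 1) r)) v)
        * P {ω | A ω = a ∧ B ω = b ∧ (∀ s, 1 ≤ s → s < r → M ω s = h s)}

/-- The Poisson pmf with (natural number) mean `μ`; `Poisson(0)` is the point mass at `0`. -/
def poissonPMF (μ : ℕ) (k : ℕ) : ℝ := Real.exp (-(μ : ℝ)) * (μ : ℝ) ^ k / (k.factorial : ℝ)

open Finset in
lemma sum_multinomialPMF_update (p : Fin 4 → ℝ) {N k : ℕ} (hk : k ≤ N) :
    ∑ w ∈ ({0, 2, 3} : Finset (Fin 4)).piAntidiag (N - k),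
      multinomialPMF N p (Function.update w 1 k)
      = (N.choose k : ℝ) * p 1 ^ k * (p 0 + p 2 + p 3) ^ (N - k) := by
  have hsum : p 0 + p 2 + p 3 = ∑ i ∈ ({0, 2, 3} : Finset (Fin 4)), p i := by
    simp [add_assoc]
  rw [hsum, sum_pow_eq_sum_piAntidiag, mul_sum]
  refine sum_congr rfl fun w hw => ?_
  rw [mem_piAntidiag] at hw
  have hw1 : w 0 + (w 2 + w 3) = N - k := by simpa using hw.1
  have hmult := Nat.multinomial_spec ({0, 2, 3} : Finset (Fin 4)) w
  rw [hw.1] at hmult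
  have hprod : ∏ i ∈ ({0, 2, 3} : Finset (Fin 4)), (w i).factorial
      = (w 0).factorial * ((w 2).factorial * (w 3).factorial) := by simp
  rw [hprod] at hmult
  have hmult' : ((w 0).factorial * ((w 2).factorial * (w 3).factorial) : ℝ)
      * Nat.multinomial ({0, 2, 3} : Finset (Fin 4)) w = (N - k).factorial := by
    exact_mod_cast hmult
  have hchoose : (N.choose k * k.factorial * (N - k).factorial : ℝ) = N.factorial := by
    exact_mod_cast Nat.choose_mul_factorial_mul_factorial hk
  have hN : w 0 + k + w 2 + w 3 = N := by omega
  have hpp : ∏ i ∈ ({0, 2, 3} : Finset (Fin 4)), p i ^ w i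
      = p 0 ^ w 0 * (p 2 ^ w 2 * p 3 ^ w 3) := by simp
  have h0 : (w 0).factorial ≠ 0 := Nat.factorial_ne_zero _
  have h2 : (w 2).factorial ≠ 0 := Nat.factorial_ne_zero _
  have h3 : (w 3).factorial ≠ 0 := Nat.factorial_ne_zero _
  have hk0 : k.factorial ≠ 0 := Nat.factorial_ne_zero _
  rw [multinomialPMF, if_pos (by simpa [Fin.sum_univ_four] using hN), hpp]
  simp only [Fin.prod_univ_four, Function.update_self, Function.update_of_ne, ne_eq,
    Fin.reduceEq, not_false_eq_true, zero_ne_one]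
  rw [← hchoose, ← hmult']
  field_simp

lemma multinomialPMF_nonneg {p : Fin 4 → ℝ} (hp : ∀ i, 0 ≤ p i) (N : ℕ) (v : Fin 4 → ℕ) :
    0 ≤ multinomialPMF N p v := by
  unfold multinomialPMF
  split_ifs
  · exact mul_nonneg (by positivity) (Finset.prod_nonneg fun i _ => pow_nonneg (hp i) _)
  · exact le_rfl

lemma prob1_add_prob2 {a : ℕ} (ha : 2 ≤ a) (f : ℕ) :
    prob1 a f + prob2 a f = ((a : ℝ) - f) / a := by
  have h2 : (2 : ℝ) ≤ a := by exact_mod_cast ha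
  have h0 : (a : ℝ) ≠ 0 := by linarith
  have h1 : (a : ℝ) - 1 ≠ 0 := by linarith
  unfold prob1 prob2
  field_simp
  ring

lemma nat_mul_pred_nonneg (f : ℕ) : (0 : ℝ) ≤ (f : ℝ) * ((f : ℝ) - 1) := by
  rcases Nat.eq_zero_or_pos f with rfl | h
  · simp
  · have : (1 : ℝ) ≤ f := by exact_mod_cast h
    exact mul_nonneg (by linarith) (by linarith)

lemma pvec_nonneg {a f : ℕ} (ha : 2 ≤ a) (hf : f ≤ a) (i : Fin 4) : 0 ≤ pvec a f i := by
  have h2 : (2 : ℝ) ≤ a := by exact_mod_cast ha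
  have hfa : (f : ℝ) ≤ a := by exact_mod_cast hf
  have hf0 : (0 : ℝ) ≤ f := Nat.cast_nonneg f
  have h1 : (0 : ℝ) ≤ (a : ℝ) - 1 := by linarith
  have h0 : prob0 a f ≤ f / a := by
    unfold prob0
    rw [div_le_div_iff₀ (by nlinarith) (by linarith)]
    have : (f : ℝ) * a * ((f : ℝ) - 1) ≤ f * a * (4 * (a - 1)) :=
      mul_le_mul_of_nonneg_left (by linarith) (by positivity)
    linarith
  fin_cases i
  · exact div_nonneg (nat_mul_pred_nonneg f) (mul_nonneg (by positivity) h1)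
  · exact div_nonneg (mul_nonneg (by linarith) hf0) (mul_nonneg (by positivity) h1)
  · refine div_nonneg ?_ (mul_nonneg (by positivity) h1)
    have := nat_mul_pred_nonneg (a - f)
    rwa [Nat.cast_sub hf] at this
  · change 0 ≤ probStar a f
    unfold probStar
    have h3 := prob1_add_prob2 ha f
    have h4 : ((a : ℝ) - f) / a = 1 - f / a := by
      rw [sub_div, div_self (by linarith)]
    linarith

lemma pvec_compl (a f : ℕ) : pvec a f 0 + pvec a f 2 + pvec a f 3 = 1 - prob1 a f := by
  simp [pvec, probStar]
  ring

lemma US_succ (a b : ℕ) (x : ℕ → ℕ) (r : ℕ) :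
    US a b x (r + 1) = US a b x r + UM1prev b x (r + 1) := by
  rcases Nat.eq_zero_or_pos r with rfl | hr
  · simp [US, UM1prev]
  · simp [US, UM1prev, Nat.pos_iff_ne_zero.1 hr]

lemma US_le {a b K R : ℕ} {x : ℕ → ℕ} (ha : a ≤ K) (hb : b ≤ K)
    (hx : ∀ r, 1 ≤ r → r ≤ R → x r ≤ K) :
    ∀ r, r ≤ R + 1 → US a b x r ≤ (r + 1) * K
  | 0, _ => by simpa [US] using ha
  | r + 1, hr => by
    have ih := US_le ha hb hx r (by omega)
    have : (if r = 0 then b else x r) ≤ K := by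
      split_ifs with h
      · exact hb
      · exact hx r (by omega) (by omega)
    rw [US]
    linarith

lemma exp_neg_le_one_sub_prob1_pow {N : ℕ} (f : ℕ) (hN : 1 ≤ N) (ha : 2 ≤ N + f) :
    prob1 (N + f) f ≤ 1 ∧ Real.exp (-(f : ℝ)) ≤ (1 - prob1 (N + f) f) ^ N := by
  rcases Nat.eq_zero_or_pos f with rfl | hf
  · simp [prob1]
  have hN' : (1 : ℝ) ≤ N := by exact_mod_cast hN
  have hf' : (1 : ℝ) ≤ f := by exact_mod_cast hf
  set y : ℝ := (N * f : ℝ)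
  set z : ℝ := ((N : ℝ) + f) * (N + f - 1)
  have hp : prob1 (N + f) f = y / z := by
    simp [prob1, y, z]
  have hzy : (N : ℝ) ^ 2 ≤ z - y := by
    simp only [z, y]
    nlinarith [mul_nonneg (sub_nonneg.2 hN') (sub_nonneg.2 hf'), mul_self_nonneg ((f : ℝ) - 1)]
  have hN2 : (0 : ℝ) < (N : ℝ) ^ 2 := by positivity
  have hy : 0 < y := by positivity
  have hz : 0 < z := by linarith
  have hzy0 : 0 < z - y := by linarith
  rw [hp]
  refine ⟨(div_le_one hz).2 (by linarith), ?_⟩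
  have h1 : Real.exp (-(y / (z - y))) ≤ 1 - y / z := by
    have h2 : z / (z - y) ≤ Real.exp (y / (z - y)) := by
      have := Real.add_one_le_exp (y / (z - y))
      have h3 : y / (z - y) + 1 = z / (z - y) := by field_simp; ring
      linarith
    rw [Real.exp_neg, show 1 - y / z = (z / (z - y))⁻¹ by field_simp]
    exact inv_anti₀ (by positivity) h2
  have h4 : (N : ℝ) * (y / (z - y)) ≤ f := by
    rw [← mul_div_assoc, div_le_iff₀ hzy0]
    have := mul_le_mul_of_nonneg_left hzy (by linarith : (0 : ℝ) ≤ f)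
    simp only [y] at this ⊢
    linarith
  calc Real.exp (-(f : ℝ)) ≤ Real.exp (N * -(y / (z - y))) := by
        apply Real.exp_le_exp.2
        linarith
    _ = Real.exp (-(y / (z - y))) ^ N := Real.exp_nat_mul _ _
    _ ≤ _ := pow_le_pow_left₀ (Real.exp_pos _).le h1 _

lemma le_sub_mul_prob1 {N f k : ℕ} (hk : k ≤ N) (hN : 1 ≤ N) (ha : 2 ≤ N + f) :
    (f : ℝ) * ((1 - k / N) * (1 - f / (N + f)) ^ 2) ≤ (N - k) * prob1 (N + f) f := by
  have hN' : (1 : ℝ) ≤ N := by exact_mod_cast hN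
  have hk' : (k : ℝ) ≤ N := by exact_mod_cast hk
  have hf' : (0 : ℝ) ≤ f := Nat.cast_nonneg f
  have ha' : (2 : ℝ) ≤ N + f := by exact_mod_cast ha
  have h1 : (f : ℝ) * ((1 - k / N) * (1 - f / (N + f)) ^ 2)
      = (N - k) * (N * f / ((N + f) * (N + f))) := by
    field_simp
    ring
  rw [h1]
  refine mul_le_mul_of_nonneg_left ?_ (by linarith)
  simp only [prob1, Nat.cast_add, add_sub_cancel_right]
  exact div_le_div_of_nonneg_left (by positivity) (mul_pos (by linarith) (by linarith))
    (mul_le_mul_of_nonneg_left (by linarith) (by linarith))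

lemma binomial_prob1_ge {N f k : ℕ} (hk : k ≤ N) (hN : 1 ≤ N) (ha : 2 ≤ N + f)
    (hkf : 2 * k * f ≤ N) :
    (1 - (k : ℝ) ^ 2 / N) * (1 - 2 * k * f / N) * poissonPMF f k
      ≤ (N.choose k : ℝ) * prob1 (N + f) f ^ k * (1 - prob1 (N + f) f) ^ (N - k) := by
  have hN' : (1 : ℝ) ≤ N := by exact_mod_cast hN
  have hk' : (k : ℝ) ≤ N := by exact_mod_cast hk
  have hf' : (0 : ℝ) ≤ f := Nat.cast_nonneg f
  have ha' : (2 : ℝ) ≤ N + f := by exact_mod_cast ha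
  have hkf' : (2 * k * f : ℝ) ≤ N := by exact_mod_cast hkf
  obtain ⟨hp1, hexp⟩ := exp_neg_le_one_sub_prob1_pow f hN ha
  have hp0 : 0 ≤ prob1 (N + f) f := pvec_nonneg ha (by omega) 1
  have hkN : (k : ℝ) / N ≤ 1 := (div_le_one (by linarith)).2 hk'
  have hfa : (f : ℝ) / (N + f) ≤ 1 := (div_le_one (by linarith)).2 (by linarith)
  have hX : 1 - (k : ℝ) ^ 2 / N ≤ (1 - k / N) ^ k := by
    have := one_add_mul_le_pow (a := -((k : ℝ) / N)) (by linarith) k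
    rw [← sub_eq_add_neg] at this
    refine le_trans (le_of_eq ?_) this
    ring
  have hY : 1 - 2 * k * f / N ≤ ((1 - (f : ℝ) / (N + f)) ^ 2) ^ k := by
    have := one_add_mul_le_pow (a := -((f : ℝ) / (N + f))) (by linarith) (2 * k)
    rw [← sub_eq_add_neg, pow_mul] at this
    refine le_trans ?_ this
    have h : (2 * k : ℝ) * f / (N + f) ≤ 2 * k * f / N :=
      div_le_div_of_nonneg_left (by positivity) (by linarith) (by linarith)
    push_cast
    rw [mul_neg, ← mul_div_assoc]
    linarith
  have hY0 : 0 ≤ 1 - (2 * k * f / N : ℝ) := by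
    rw [sub_nonneg, div_le_one (by linarith)]
    exact hkf'
  have hdesc : ((N : ℝ) - k) ^ k ≤ k.factorial * N.choose k := by
    rw [← Nat.cast_sub hk]
    exact_mod_cast (Nat.pow_le_pow_left (by omega) k).trans
      ((Nat.pow_sub_le_descFactorial N k).trans_eq (Nat.descFactorial_eq_factorial_mul_choose N k))
  have hmain : (1 - (k : ℝ) ^ 2 / N) * (1 - 2 * k * f / N) * (f : ℝ) ^ k
      ≤ k.factorial * N.choose k * prob1 (N + f) f ^ k :=
    calc _ ≤ (1 - (k : ℝ) / N) ^ k * ((1 - (f : ℝ) / (N + f)) ^ 2) ^ k * (f : ℝ) ^ k :=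
          mul_le_mul_of_nonneg_right
            (mul_le_mul hX hY hY0 (pow_nonneg (by linarith) _)) (by positivity)
      _ = ((f : ℝ) * ((1 - k / N) * (1 - f / (N + f)) ^ 2)) ^ k := by
          rw [mul_pow, mul_pow, mul_comm]
      _ ≤ ((N - k) * prob1 (N + f) f) ^ k :=
          pow_le_pow_left₀ (mul_nonneg hf' (mul_nonneg (by linarith) (sq_nonneg _)))
            (le_sub_mul_prob1 hk hN ha) k
      _ ≤ _ := by
          rw [mul_pow]
          exact mul_le_mul_of_nonneg_right hdesc (pow_nonneg hp0 _)
  have hpow : Real.exp (-(f : ℝ)) ≤ (1 - prob1 (N + f) f) ^ (N - k) :=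
    hexp.trans (pow_le_pow_of_le_one (by linarith) (by linarith) (Nat.sub_le N k))
  have hfac : (0 : ℝ) < k.factorial := by exact_mod_cast k.factorial_pos
  calc _ = (1 - (k : ℝ) ^ 2 / N) * (1 - 2 * k * f / N) * (f : ℝ) ^ k / k.factorial
          * Real.exp (-(f : ℝ)) := by
        rw [poissonPMF]
        ring
    _ ≤ (N.choose k : ℝ) * prob1 (N + f) f ^ k * Real.exp (-(f : ℝ)) := by
        refine mul_le_mul_of_nonneg_right ?_ (Real.exp_pos _).le
        rw [div_le_iff₀ hfac]
        linarith
    _ ≤ _ := mul_le_mul_of_nonneg_left hpow (by positivity)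

lemma under_chain_step {n : ℕ} {q : ℝ} {Ω : Type*} [MeasurableSpace Ω] {P : Measure Ω}
    {A B : Ω → ℕ} {M : Ω → ℕ → Fin 4 → ℕ} (hc : IsUnderChain n q P A B M)
    (a b : ℕ) (x : ℕ → ℕ) {t N f : ℕ} (ht : t + 1 ≤ RparU n q)
    (hN : n - US a b x (t + 1) = N) (hf : UM1prev b x (t + 1) = f)
    (hNf : n - US a b x t = N + f) (h2 : 2 ≤ N + f) (hk : x (t + 1) ≤ N) :
    ENNReal.ofReal ((N.choose (x (t + 1)) : ℝ) * prob1 (N + f) f ^ (x (t + 1))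
        * (1 - prob1 (N + f) f) ^ (N - x (t + 1)))
      * P {ω | A ω = a ∧ B ω = b ∧ ∀ r, 1 ≤ r → r ≤ t → M ω r 1 = x r}
    ≤ P {ω | A ω = a ∧ B ω = b ∧ ∀ r, 1 ≤ r → r ≤ t + 1 → M ω r 1 = x r} := by
  obtain ⟨hA, hB, hM, -, -, hstep⟩ := hc
  set W := ({0, 2, 3} : Finset (Fin 4)).piAntidiag (N - x (t + 1)) with hW
  set p := pvec (N + f) f with hp
  have hp0 : ∀ i, 0 ≤ p i := pvec_nonneg h2 (by omega)
  let H := {g : Fin t → Fin 4 → ℕ // ∀ i, g i 1 = x (i + 1)}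
  let hist : H → ℕ → Fin 4 → ℕ := fun g s =>
    if hs : 1 ≤ s ∧ s ≤ t then g.1 ⟨s - 1, by omega⟩ else fun _ => x s
  have hist1 : ∀ g, (fun s => hist g s 1) = x := by
    intro g
    funext s
    by_cases hs : 1 ≤ s ∧ s ≤ t
    · simp only [hist, dif_pos hs, g.2]
      congr 1
      omega
    · simp only [hist, dif_neg hs]
  have hist_inj : ∀ g g', (∀ s, 1 ≤ s → s < t + 1 → hist g s = hist g' s) → g = g' := by
    intro g g' h
    apply Subtype.ext
    funext i
    have := h (i + 1) (by omega) (by omega)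
    simpa [hist, show 1 ≤ (i : ℕ) + 1 ∧ (i : ℕ) + 1 ≤ t by omega] using this
  let C : H → Set Ω := fun g =>
    {ω | A ω = a ∧ B ω = b ∧ ∀ s, 1 ≤ s → s < t + 1 → M ω s = hist g s}
  let D : H → (Fin 4 → ℕ) → Set Ω := fun g w =>
    {ω | A ω = a ∧ B ω = b ∧ (∀ s, 1 ≤ s → s < t + 1 → M ω s = hist g s)
      ∧ M ω (t + 1) = Function.update w 1 (x (t + 1))}
  have hDm : ∀ g w, MeasurableSet (D g w) := by
    intro g w
    have h1 : MeasurableSet {ω | A ω = a} := hA (measurableSet_singleton a)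
    have h2 : MeasurableSet {ω | B ω = b} := hB (measurableSet_singleton b)
    have h3 : ∀ s v, MeasurableSet {ω | M ω s = v} := fun s v => hM s (measurableSet_singleton v)
    have h4 : MeasurableSet {ω | ∀ s, 1 ≤ s → s < t + 1 → M ω s = hist g s} := by
      simp only [Set.ofPred_forall]
      exact .iInter fun s => .iInter fun _ => .iInter fun _ => h3 _ _
    exact h1.inter (h2.inter (h4.inter (h3 _ _)))
  have hDP : ∀ g w, P (D g w)
      = ENNReal.ofReal (multinomialPMF N p (Function.update w 1 (x (t + 1)))) * P (C g) := by
    intro g w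
    have := hstep (t + 1) (by omega) ht a b (hist g) (Function.update w 1 (x (t + 1)))
    rw [hist1 g, hN, hf, Nat.add_sub_cancel, hNf] at this
    exact this
  have hbin : ENNReal.ofReal ((N.choose (x (t + 1)) : ℝ) * prob1 (N + f) f ^ (x (t + 1))
        * (1 - prob1 (N + f) f) ^ (N - x (t + 1)))
      = ∑ w ∈ W, ENNReal.ofReal (multinomialPMF N p (Function.update w 1 (x (t + 1)))) := by
    rw [← ENNReal.ofReal_sum_of_nonneg fun w _ => multinomialPMF_nonneg hp0 _ _,
      sum_multinomialPMF_update p hk, hp, pvec_compl]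
    rfl
  have hcover : {ω | A ω = a ∧ B ω = b ∧ ∀ r, 1 ≤ r → r ≤ t → M ω r 1 = x r} ⊆ ⋃ g, C g := by
    rintro ω ⟨h1, h2, h3⟩
    refine Set.mem_iUnion.2 ⟨⟨fun i => M ω (i + 1), fun i => h3 _ (by omega) (by omega)⟩,
      h1, h2, fun s hs1 hs2 => ?_⟩
    simp only [hist, dif_pos (show 1 ≤ s ∧ s ≤ t by omega), Nat.sub_add_cancel hs1]
  have hWinj : ∀ w ∈ W, ∀ w' ∈ W,
      Function.update w 1 (x (t + 1)) = Function.update w' 1 (x (t + 1)) → w = w' := by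
    intro w hw w' hw' h
    have hz : ∀ w ∈ W, w 1 = 0 := by
      intro w hw
      by_contra h
      simpa using (Finset.mem_piAntidiag.1 hw).2 1 h
    funext i
    by_cases hi : i = 1
    · rw [hi, hz w hw, hz w' hw']
    · simpa [hi] using congrFun h i
  have hDdisj : Pairwise (Function.onFun Disjoint fun g => ⋃ w ∈ W, D g w) := by
    intro g g' hgg
    refine Set.disjoint_left.2 fun ω h1 h2 => hgg ?_
    simp only [Set.mem_iUnion] at h1 h2
    obtain ⟨w, -, -, -, h1, -⟩ := h1
    obtain ⟨w', -, -, -, h2, -⟩ := h2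
    exact hist_inj g g' fun s hs hs' => (h1 s hs hs').symm.trans (h2 s hs hs')
  have hWdisj : ∀ g, (W : Set (Fin 4 → ℕ)).PairwiseDisjoint (D g) := by
    intro g w hw w' hw' hww
    refine Set.disjoint_left.2 fun ω h1 h2 => hww ?_
    exact hWinj w hw w' hw' (h1.2.2.2.symm.trans h2.2.2.2)
  calc _ ≤ ENNReal.ofReal _ * ∑' g, P (C g) :=
        mul_le_mul_right ((measure_mono hcover).trans (measure_iUnion_le _)) _
    _ = ∑' g, P (⋃ w ∈ W, D g w) := by
        rw [← ENNReal.tsum_mul_left]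
        refine tsum_congr fun g => ?_
        rw [measure_biUnion_finset (hWdisj g) fun w _ => hDm g w, hbin, Finset.sum_mul]
        exact Finset.sum_congr rfl fun w _ => (hDP g w).symm
    _ = P (⋃ g, ⋃ w ∈ W, D g w) :=
        (measure_iUnion hDdisj fun g => Finset.measurableSet_biUnion _ fun w _ => hDm g w).symm
    _ ≤ _ := by
        refine measure_mono fun ω hω => ?_
        simp only [Set.mem_iUnion] at hω
        obtain ⟨g, w, -, h1, h2, h3, h4⟩ := hω
        refine ⟨h1, h2, fun r hr1 hr2 => ?_⟩
        rcases Nat.lt_or_ge r (t + 1) with hr | hr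
        · rw [h3 r hr1 hr]
          exact congrFun (hist1 g) r
        · obtain rfl : r = t + 1 := by omega
          rw [h4, Function.update_self]

lemma tendsto_sq_floor_div (q : ℝ) (hq0 : 0 < q) (hq : q < 1 / 2) :
    Tendsto (fun n : ℕ => (⌊(n : ℝ) ^ q * Real.log n⌋₊ : ℝ) ^ 2 / n) atTop (𝓝 0) := by
  have h : Tendsto (fun n : ℕ => (Real.log n / (n : ℝ) ^ (1 / 2 - q)) ^ 2) atTop (𝓝 0) := by
    have h1 := (isLittleO_log_rpow_atTop (r := 1 / 2 - q) (by linarith)).tendsto_div_nhds_zero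
    simpa using (h1.comp tendsto_natCast_atTop_atTop).pow 2
  refine squeeze_zero' (.of_forall fun n => by positivity) ?_ h
  filter_upwards [eventually_ge_atTop 2] with n hn
  have hn' : (2 : ℝ) ≤ n := by exact_mod_cast hn
  have hlog : 0 < Real.log n := Real.log_pos (by linarith)
  have hK : (⌊(n : ℝ) ^ q * Real.log n⌋₊ : ℝ) ≤ (n : ℝ) ^ q * Real.log n :=
    Nat.floor_le (by positivity)
  have hnpow : ((n : ℝ) ^ q * (n : ℝ) ^ (1 / 2 - q)) ^ 2 = n := by
    rw [← Real.rpow_add (by linarith), add_sub_cancel, ← Real.sqrt_eq_rpow,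
      Real.sq_sqrt (by linarith)]
  have hpos : 0 < (n : ℝ) ^ (1 / 2 - q) := by positivity
  rw [div_pow, div_le_div_iff₀ (by linarith) (by positivity)]
  calc _ ≤ ((n : ℝ) ^ q * Real.log n) ^ 2 * ((n : ℝ) ^ (1 / 2 - q)) ^ 2 := by gcongr
    _ = Real.log n ^ 2 * ((n : ℝ) ^ q * (n : ℝ) ^ (1 / 2 - q)) ^ 2 := by ring
    _ = _ := by rw [hnpow]

lemma tendsto_RparU_mul_sq_floor_div (q : ℝ) :
    Tendsto (fun n : ℕ => (RparU n q : ℝ) * ((⌊(n : ℝ) ^ q * Real.log n⌋₊ : ℝ) ^ 2 / n))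
      atTop (𝓝 0) := by
  have h : Tendsto (fun n : ℕ => (Real.log n)⁻¹) atTop (𝓝 0) :=
    (Real.tendsto_log_atTop.comp tendsto_natCast_atTop_atTop).inv_tendsto_atTop
  refine squeeze_zero' (.of_forall fun n => by positivity) ?_ h
  filter_upwards [eventually_ge_atTop 2] with n hn
  have hn' : (2 : ℝ) ≤ n := by exact_mod_cast hn
  have hn0 : (n : ℝ) ≠ 0 := by linarith
  have hlog : 0 < Real.log n := Real.log_pos (by linarith)
  have hK : (⌊(n : ℝ) ^ q * Real.log n⌋₊ : ℝ) ≤ (n : ℝ) ^ q * Real.log n :=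
    Nat.floor_le (by positivity)
  have hR : (RparU n q : ℝ) ≤ (n : ℝ) ^ (1 - 2 * q) / (Real.log n) ^ 3 :=
    Nat.floor_le (by positivity)
  have hnpow : (n : ℝ) ^ (1 - 2 * q) * ((n : ℝ) ^ q) ^ 2 = n := by
    rw [← Real.rpow_natCast, ← Real.rpow_mul (by linarith), ← Real.rpow_add (by linarith)]
    norm_num
    rw [show 1 - 2 * q + q * 2 = 1 by ring, Real.rpow_one]
  calc _ ≤ (n : ℝ) ^ (1 - 2 * q) / (Real.log n) ^ 3 * (((n : ℝ) ^ q * Real.log n) ^ 2 / n) := by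
        gcongr
    _ = (n : ℝ) ^ (1 - 2 * q) * ((n : ℝ) ^ q) ^ 2 / n * (Real.log n)⁻¹ := by
        field_simp
    _ = _ := by rw [hnpow, div_self hn0, one_mul]

lemma poissonPMF_nonneg (μ k : ℕ) : 0 ≤ poissonPMF μ k := by
  unfold poissonPMF
  positivity

lemma one_sub_mul_poissonPMF_le {n N f k K : ℕ} (hn : 4 ≤ n) (hnN : n ≤ 2 * N) (hf : f ≤ K)
    (hk : k ≤ K) (hKN : K ≤ N) (hK2 : 6 * K ^ 2 ≤ n) :
    (1 - 6 * ((K : ℝ) ^ 2 / n)) * poissonPMF f k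
      ≤ (N.choose k : ℝ) * prob1 (N + f) f ^ k * (1 - prob1 (N + f) f) ^ (N - k) := by
  have hkf : k * f ≤ K ^ 2 := by
    rw [sq]
    exact Nat.mul_le_mul hk hf
  refine le_trans (mul_le_mul_of_nonneg_right ?_ (poissonPMF_nonneg f k))
    (binomial_prob1_ge (hk.trans hKN) (by omega) (by omega) (by rw [mul_assoc]; omega))
  have hn0 : (4 : ℝ) ≤ n := by exact_mod_cast hn
  have hnN' : (n : ℝ) ≤ 2 * N := by exact_mod_cast hnN
  have hkf' : (k * f : ℝ) ≤ K ^ 2 := by exact_mod_cast hkf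
  have hk' : (k : ℝ) ^ 2 ≤ K ^ 2 := by exact_mod_cast Nat.pow_le_pow_left hk 2
  have h1 : (k : ℝ) ^ 2 / N ≤ 2 * ((K : ℝ) ^ 2 / n) := by
    rw [← mul_div_assoc, div_le_div_iff₀ (by linarith) (by linarith)]
    nlinarith [mul_le_mul hk' hnN' (by linarith) (by positivity)]
  have h2 : 2 * k * f / N ≤ 4 * ((K : ℝ) ^ 2 / n) := by
    rw [← mul_div_assoc, div_le_div_iff₀ (by linarith) (by linarith)]
    nlinarith [mul_le_mul hkf' hnN' (by linarith) (by positivity)]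
  have h3 : (0 : ℝ) ≤ (k : ℝ) ^ 2 / N := by positivity
  have h4 : (0 : ℝ) ≤ 2 * k * f / N := by positivity
  nlinarith [mul_nonneg h3 h4]

lemma under_chain_trajectory_ge {n : ℕ} {q : ℝ} {Ω : Type*} [MeasurableSpace Ω] {P : Measure Ω}
    [IsProbabilityMeasure P] {A B : Ω → ℕ} {M : Ω → ℕ → Fin 4 → ℕ}
    (hc : IsUnderChain n q P A B M) {a b K : ℕ} {x : ℕ → ℕ} (hn : 4 ≤ n)
    (hRK : 2 * ((RparU n q + 2) * K) ≤ n) (hK2 : 6 * K ^ 2 ≤ n) (ha : a ≤ K) (hb : b ≤ K)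
    (hx : ∀ r, 1 ≤ r → r ≤ RparU n q → x r ≤ K) :
    ∀ t, t ≤ RparU n q →
      (1 - 6 * ((K : ℝ) ^ 2 / n)) ^ t
        * ((∏ r ∈ Finset.Icc 1 t, poissonPMF (if r = 1 then b else x (r - 1)) (x r))
          * (P {ω | A ω = a ∧ B ω = b}).toReal)
      ≤ (P {ω | A ω = a ∧ B ω = b ∧ ∀ r, 1 ≤ r → r ≤ t → M ω r 1 = x r}).toReal
  | 0, _ => by
    have h : ∀ ω, (∀ r, 1 ≤ r → r ≤ 0 → M ω r 1 = x r) ↔ True :=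
      fun ω => iff_true_intro fun r h1 h2 => by omega
    simp only [h]
    simp
  | t + 1, ht => by
    have ih := under_chain_trajectory_ge hc hn hRK hK2 ha hb hx t (by omega)
    set f := if t + 1 = 1 then b else x (t + 1 - 1) with hfdef
    have hfU : UM1prev b x (t + 1) = f := by simp [UM1prev, hfdef]
    have hfK : f ≤ K := by
      rw [hfdef]
      split_ifs with h
      · exact hb
      · exact hx _ (by omega) (by omega)
    have hkK : x (t + 1) ≤ K := hx _ (by omega) ht
    have hUS : US a b x (t + 1) ≤ (RparU n q + 1) * K :=
      (US_le ha hb hx (t + 1) (by omega)).trans (Nat.mul_le_mul_right K (by omega))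
    have hsplit : (RparU n q + 2) * K = (RparU n q + 1) * K + K := by ring
    have hsucc := US_succ a b x t
    rw [hfU] at hsucc
    have hδ : 0 ≤ 1 - 6 * ((K : ℝ) ^ 2 / n) := by
      have hn0 : (4 : ℝ) ≤ n := by exact_mod_cast hn
      rw [sub_nonneg, ← mul_div_assoc, div_le_one (by linarith)]
      exact_mod_cast hK2
    have hle := one_sub_mul_poissonPMF_le (N := n - US a b x (t + 1)) hn (by omega) hfK hkK
      (by omega) hK2
    have hstep := under_chain_step hc a b x ht rfl hfU (by omega) (by omega) (by omega)
    have hstep' := ENNReal.toReal_mono (measure_ne_top P _) hstep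
    rw [ENNReal.toReal_mul, ENNReal.toReal_ofReal
      ((mul_nonneg hδ (poissonPMF_nonneg _ _)).trans hle)] at hstep'
    refine le_trans ?_ hstep'
    rw [Finset.prod_Icc_succ_top (by omega), pow_succ]
    refine le_trans (le_of_eq ?_) (mul_le_mul hle ih (mul_nonneg (pow_nonneg hδ _)
      (mul_nonneg (Finset.prod_nonneg fun _ _ => poissonPMF_nonneg _ _) ENNReal.toReal_nonneg))
      ((mul_nonneg hδ (poissonPMF_nonneg _ _)).trans hle))
    rw [← hfdef]
    ring

/-- Poisson comparison for the under-constrained counting chain with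
`q ∈ (0,1/3)`.  There is `E(n) → 1` such that for all trajectories
`x^{(−1)}, x^{(0)}, …, x^{(R)} ∈ {0,…,⌊n^q log n⌋}`,
`P(M₁^{(r)} = x^{(r)} ∀ r ∈ [1,R] | M₁^{(−1)} = x^{(−1)}, M₁^{(0)} = x^{(0)})` is at least
`E(n)` times the corresponding probability for the Poisson comparison chain
`X^{(r)} | X^{(r−1)} ~ Poisson(X^{(r−1)})`, whose conditional trajectory probability is
`∏_{r=1}^{R} poissonPMF(x^{(r−1)}, x^{(r)})`.  (Both sides are multiplied by
`P(M₁^{(−1)} = x^{(−1)}, M₁^{(0)} = x^{(0)})`.) -/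
theorem statement18 (q : ℝ) (hq0 : 0 < q) (hq : q < 1 / 3)
    (C₀ : ℝ) (hC₀ : 0 < C₀)
    (Ω : ℕ → Type*) [∀ n, MeasurableSpace (Ω n)]
    (P : ∀ n, Measure (Ω n)) [∀ n, IsProbabilityMeasure (P n)]
    (A B : ∀ n, Ω n → ℕ) (M : ∀ n, Ω n → ℕ → Fin 4 → ℕ)
    (hchain : ∀ n, 2 ≤ n → IsUnderChain n q (P n) (A n) (B n) (M n))
    (hEB : ∀ n, (∑' v : ℕ, (v : ℝ≥0∞) * (P n) {ω | B n ω = v})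
      ≤ ENNReal.ofReal (C₀ * (n : ℝ) ^ q))
    (hAt : Tendsto (fun n => ((P n) {ω | (A n ω : ℝ) ≤ (n : ℝ) ^ q * Real.log n}).toReal)
      atTop (𝓝 1))
    (hBt : Tendsto (fun n => ((P n) {ω | (B n ω : ℝ) ≤ (n : ℝ) ^ q * Real.log n}).toReal)
      atTop (𝓝 1)) :
    ∃ E : ℕ → ℝ, Tendsto E atTop (𝓝 1) ∧
      ∀ n : ℕ, 2 ≤ n → ∀ xm1 x0 : ℕ, ∀ x : ℕ → ℕ,
        xm1 ≤ ⌊(n : ℝ) ^ q * Real.log n⌋₊ → x0 ≤ ⌊(n : ℝ) ^ q * Real.log n⌋₊ →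
        (∀ r, 1 ≤ r → r ≤ RparU n q → x r ≤ ⌊(n : ℝ) ^ q * Real.log n⌋₊) →
        E n * ((∏ r ∈ Finset.Icc 1 (RparU n q),
                poissonPMF (if r = 1 then x0 else x (r - 1)) (x r))
              * ((P n) {ω | A n ω = xm1 ∧ B n ω = x0}).toReal)
          ≤ ((P n) {ω | A n ω = xm1 ∧ B n ω = x0 ∧
              ∀ r, 1 ≤ r → r ≤ RparU n q → M n ω r 1 = x r}).toReal := by
  classical
  let K : ℕ → ℕ := fun n => ⌊(n : ℝ) ^ q * Real.log n⌋₊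
  have hu := tendsto_sq_floor_div q hq0 (by linarith)
  have hv := tendsto_RparU_mul_sq_floor_div q
  let good : ℕ → Prop := fun n => 4 ≤ n ∧ 2 * ((RparU n q + 2) * K n) ≤ n ∧ 6 * K n ^ 2 ≤ n
  have hgood : ∀ᶠ n in atTop, good n := by
    filter_upwards [eventually_ge_atTop 4, hu.eventually_le_const (by norm_num : (0 : ℝ) < 1 / 8),
      hv.eventually_le_const (by norm_num : (0 : ℝ) < 1 / 4)] with n hn hun hvn
    have hn0 : (0 : ℝ) < n := by
      have : (4 : ℝ) ≤ n := by exact_mod_cast hn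
      linarith
    have h1 : 8 * K n ^ 2 ≤ n := by
      rw [div_le_iff₀ hn0] at hun
      have : (8 * (K n : ℝ) ^ 2) ≤ n := by linarith
      exact_mod_cast this
    have h2 : 4 * (RparU n q * K n ^ 2) ≤ n := by
      rw [← mul_div_assoc, div_le_iff₀ hn0] at hvn
      have : (4 * (RparU n q * (K n : ℝ) ^ 2)) ≤ n := by linarith
      exact_mod_cast this
    have h3 : K n ≤ K n ^ 2 := Nat.le_self_pow two_ne_zero _
    refine ⟨hn, ?_, by omega⟩
    have h4 : (RparU n q + 2) * K n ≤ RparU n q * K n ^ 2 + 2 * K n ^ 2 := by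
      rw [← add_mul]
      exact Nat.mul_le_mul_left _ h3
    omega
  refine ⟨fun n => if good n then 1 - 6 * (RparU n q * ((K n : ℝ) ^ 2 / n)) else 0, ?_, ?_⟩
  · have h : Tendsto (fun n : ℕ => 1 - 6 * (RparU n q * ((K n : ℝ) ^ 2 / n))) atTop (𝓝 1) := by
      simpa using (hv.const_mul 6).const_sub 1
    refine h.congr' ?_
    filter_upwards [hgood] with n hn
    rw [if_pos hn]
  · intro n hn a b x ha hb hx
    beta_reduce
    by_cases hg : good n
    · rw [if_pos hg]
      obtain ⟨h4, hRK, hK2⟩ := hg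
      refine le_trans (mul_le_mul_of_nonneg_right ?_ ?_)
        (under_chain_trajectory_ge (hchain n hn) h4 hRK hK2 ha hb hx _ le_rfl)
      · have hn0 : (0 : ℝ) < n := by
          have : (4 : ℝ) ≤ n := by exact_mod_cast h4
          linarith
        have hδ : 6 * ((K n : ℝ) ^ 2 / n) ≤ 1 := by
          rw [← mul_div_assoc, div_le_one hn0]
          exact_mod_cast hK2
        have := one_add_mul_le_pow (a := -(6 * ((K n : ℝ) ^ 2 / n))) (by linarith) (RparU n q)
        rw [← sub_eq_add_neg] at this
        refine le_trans (le_of_eq ?_) this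
        ring
      · exact mul_nonneg (Finset.prod_nonneg fun _ _ => poissonPMF_nonneg _ _)
          ENNReal.toReal_nonneg
    · rw [if_neg hg, zero_mul]
      exact ENNReal.toReal_nonneg
end
end

section
/- Fix 0 < q < 1/3 and a constant C₀ > 0, and for each n set R = ⌊n^{1−2q}/log³ n⌋. For each n let X^{(0)} be an ℕ-valued random variable with E[X^{(0)}] ≤ C₀·n^q, and for r = 1,…,R let X^{(r)} be such that conditionally on X^{(r−1)} the variable X^{(r)} has the Poisson distribution with mean X^{(r−1)} (equivalently, (X^{(r)}) is a Galton–Watson branching process with Poisson(1) offspring distribution started from X^{(0)}). Then P(X^{(R)} = 0) → 1 as n → ∞. -/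
open Filter Topology MeasureTheory ENNReal

noncomputable section

/-- The Poisson (critical Galton–Watson) chain: for `r ∈ {1,…,R}`, conditionally on
`X^{(0)},…,X^{(r−1)}`, the variable `X^{(r)}` has the Poisson distribution with mean
`X^{(r−1)}`. -/
def IsPoissonChain (n : ℕ) (q : ℝ) {Ω : Type*} [MeasurableSpace Ω] (P : Measure Ω)
    (X : Ω → ℕ → ℕ) : Prop :=
  (∀ r, Measurable (fun ω => X ω r)) ∧
  ∀ r : ℕ, 1 ≤ r → r ≤ RparU n q → ∀ h : ℕ → ℕ, ∀ v : ℕ,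
    P {ω | (∀ s, s < r → X ω s = h s) ∧ X ω r = v}
      = ENNReal.ofReal (poissonPMF (h (r - 1)) v)
        * P {ω | ∀ s, s < r → X ω s = h s}

lemma hasSum_pow_mul_poissonPMF (a : ℝ) (μ : ℕ) :
    HasSum (fun k => a ^ k * poissonPMF μ k) (Real.exp (a - 1) ^ μ) := by
  have h : HasSum (fun k : ℕ => (a * μ) ^ k / (k.factorial : ℝ)) (Real.exp (a * μ)) := by
    rw [Real.exp_eq_exp_ℝ]
    exact NormedSpace.expSeries_div_hasSum_exp (a * μ)
  have h' := h.mul_left (Real.exp (-(μ : ℝ)))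
  have e : Real.exp (a - 1) ^ μ = Real.exp (-(μ : ℝ)) * Real.exp (a * μ) := by
    rw [← Real.exp_nat_mul, ← Real.exp_add]
    ring_nf
  rw [e]
  have hterm : (fun k => a ^ k * poissonPMF μ k)
      = fun k => Real.exp (-(μ : ℝ)) * ((a * μ) ^ k / (k.factorial : ℝ)) := by
    funext k
    simp only [poissonPMF, mul_pow]
    ring
  rw [hterm]
  exact h'

/-- The one-step law of a Poisson chain, averaged over its past. -/
lemma IsPoissonChain.measure_eq_lintegral {n : ℕ} {q : ℝ} {Ω : Type*} [MeasurableSpace Ω]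
    {P : Measure Ω} {X : Ω → ℕ → ℕ} (hX : IsPoissonChain n q P X) {r : ℕ}
    (hr : r + 1 ≤ RparU n q) (v : ℕ) :
    P {ω | X ω (r + 1) = v} = ∫⁻ ω, ENNReal.ofReal (poissonPMF (X ω r) v) ∂P := by
  obtain ⟨hm, hstep⟩ := hX
  let H : Ω → (Fin (r + 1) → ℕ) := fun ω i => X ω i
  have hH : Measurable H := measurable_pi_lambda _ fun i => hm i
  let ext : (Fin (r + 1) → ℕ) → ℕ → ℕ := fun g s => if hs : s < r + 1 then g ⟨s, hs⟩ else 0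
  have hset (g : Fin (r + 1) → ℕ) : H ⁻¹' {g} = {ω | ∀ s, s < r + 1 → X ω s = ext g s} := by
    ext ω
    simp only [Set.mem_preimage, Set.mem_singleton_iff, Set.mem_ofPred_eq, funext_iff,
      Fin.forall_iff, H, ext]
    exact forall_congr' fun s => forall_congr' fun hs => by rw [dif_pos hs]
  calc P {ω | X ω (r + 1) = v}
      = (P.restrict {ω | X ω (r + 1) = v}).map H Set.univ := by
        rw [Measure.map_apply hH .univ]; simp
    _ = ∑' g, (P.restrict {ω | X ω (r + 1) = v}).map H {g} := by
        rw [← lintegral_one, lintegral_countable']; simp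
    _ = ∑' g, ENNReal.ofReal (poissonPMF (g (Fin.last r)) v) * P.map H {g} := by
        refine tsum_congr fun g => ?_
        have h := hstep (r + 1) (by omega) hr (ext g) v
        rw [Measure.map_apply hH (measurableSet_singleton g),
          Measure.map_apply hH (measurableSet_singleton g),
          Measure.restrict_apply (hH (measurableSet_singleton g)), hset]
        have e : ext g (r + 1 - 1) = g (Fin.last r) := by simp [ext, Fin.last]
        rw [e] at h
        exact h
    _ = ∫⁻ g, ENNReal.ofReal (poissonPMF (g (Fin.last r)) v) ∂P.map H := by
        rw [lintegral_countable']
    _ = ∫⁻ ω, ENNReal.ofReal (poissonPMF (X ω r) v) ∂P := by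
        rw [lintegral_map (measurable_of_countable _) hH]; rfl

lemma lintegral_comp_nat {Ω : Type*} [MeasurableSpace Ω] (P : Measure Ω) {Y : Ω → ℕ}
    (hY : Measurable Y) (f : ℕ → ℝ≥0∞) :
    ∫⁻ ω, f (Y ω) ∂P = ∑' v, f v * P {ω | Y ω = v} := by
  rw [← lintegral_map (measurable_of_countable f) hY, lintegral_countable']
  refine tsum_congr fun v => ?_
  rw [Measure.map_apply hY (measurableSet_singleton v)]
  rfl

/-- The generating function of a Poisson chain satisfies the branching recursion. -/
lemma IsPoissonChain.lintegral_pow_succ {n : ℕ} {q : ℝ} {Ω : Type*} [MeasurableSpace Ω]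
    {P : Measure Ω} {X : Ω → ℕ → ℕ} (hX : IsPoissonChain n q P X) {r : ℕ}
    (hr : r + 1 ≤ RparU n q) {a : ℝ} (ha : 0 ≤ a) :
    ∫⁻ ω, ENNReal.ofReal (a ^ X ω (r + 1)) ∂P
      = ∫⁻ ω, ENNReal.ofReal (Real.exp (a - 1) ^ X ω r) ∂P := by
  rw [lintegral_comp_nat P (hX.1 (r + 1)) fun k => ENNReal.ofReal (a ^ k)]
  have hmeas (v : ℕ) : Measurable fun ω => ENNReal.ofReal (poissonPMF (X ω r) v) :=
    (measurable_of_countable fun k => ENNReal.ofReal (poissonPMF k v)).comp (hX.1 r)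
  simp_rw [hX.measure_eq_lintegral hr, ← lintegral_const_mul _ (hmeas _)]
  rw [← lintegral_tsum fun v => ((hmeas v).const_mul _).aemeasurable]
  refine lintegral_congr fun ω => ?_
  have h := hasSum_pow_mul_poissonPMF a (X ω r)
  simp_rw [← ENNReal.ofReal_mul (pow_nonneg ha _)]
  rw [← h.tsum_eq, ENNReal.ofReal_tsum_of_nonneg
    (fun k => mul_nonneg (pow_nonneg ha k) (poissonPMF_nonneg _ k)) h.summable]

/-- The probability that a critical `Poisson(1)` branching process started from one individual
is extinct by generation `k`. -/
def poissonExtinctionProb : ℕ → ℝ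
  | 0 => 0
  | k + 1 => Real.exp (poissonExtinctionProb k - 1)

lemma poissonExtinctionProb_nonneg : ∀ k, 0 ≤ poissonExtinctionProb k
  | 0 => le_rfl
  | _ + 1 => (Real.exp_pos _).le

lemma one_sub_exp_neg_le {d : ℝ} (h0 : 0 ≤ d) (h1 : d ≤ 1) :
    1 - Real.exp (-d) ≤ d - d ^ 2 / 4 := by
  have h := Real.exp_bound (x := -d) (by rwa [abs_neg, abs_of_nonneg h0]) (n := 3) (by norm_num)
  rw [abs_neg, abs_of_nonneg h0] at h
  have h' := (abs_le.mp h).1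
  norm_num [Finset.sum_range_succ, Nat.factorial] at h'
  nlinarith [mul_nonneg (sq_nonneg d) (sub_nonneg.mpr h1)]

lemma one_sub_poissonExtinctionProb_mem (k : ℕ) :
    0 ≤ 1 - poissonExtinctionProb k ∧ 1 - poissonExtinctionProb k ≤ 4 / (k + 4) := by
  induction k with
  | zero => norm_num [poissonExtinctionProb]
  | succ k ih =>
    obtain ⟨h0, hk⟩ := ih
    set d := 1 - poissonExtinctionProb k with hd
    have hk4 : (0 : ℝ) < k + 4 := by positivity
    have h1 : d ≤ 1 := by linarith [poissonExtinctionProb_nonneg k]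
    have e : poissonExtinctionProb (k + 1) = Real.exp (-d) := by
      rw [poissonExtinctionProb, hd, neg_sub]
    rw [e]
    refine ⟨by simpa using h0, (one_sub_exp_neg_le h0 h1).trans ?_⟩
    have hD : d * (k + 4) ≤ 4 := (le_div_iff₀ hk4).mp hk
    have hD' : d - d ^ 2 / 4 ≤ 4 / (k + 4) - (4 / (k + 4)) ^ 2 / 4 := by
      have : 4 / ((k : ℝ) + 4) ≤ 1 := by
        rw [div_le_one hk4]; linarith [(Nat.cast_nonneg k : (0 : ℝ) ≤ k)]
      nlinarith
    refine hD'.trans ?_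
    rw [div_pow, div_div, div_sub_div _ _ (by positivity) (by positivity),
      div_le_div_iff₀ (by positivity) (by positivity)]
    push_cast
    have : (0 : ℝ) ≤ k := Nat.cast_nonneg k
    nlinarith [pow_pos hk4 2, pow_pos hk4 3]

lemma IsPoissonChain.lintegral_extinction {n : ℕ} {q : ℝ} {Ω : Type*} [MeasurableSpace Ω]
    {P : Measure Ω} {X : Ω → ℕ → ℕ} (hX : IsPoissonChain n q P X) (r : ℕ) :
    ∀ k, r + k ≤ RparU n q →
      ∫⁻ ω, ENNReal.ofReal (poissonExtinctionProb k ^ X ω r) ∂P = P {ω | X ω (r + k) = 0} := by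
  intro k
  induction k generalizing r with
  | zero =>
    intro _
    rw [lintegral_comp_nat P (hX.1 r) fun j => ENNReal.ofReal (poissonExtinctionProb 0 ^ j),
      tsum_eq_single 0]
    · simp
    · intro j hj
      simp [poissonExtinctionProb, hj]
  | succ k ih =>
    intro hr
    rw [poissonExtinctionProb,
      ← hX.lintegral_pow_succ (by omega) (poissonExtinctionProb_nonneg k),
      ih (r + 1) (by omega)]
    congr 3
    ring_nf

/-- The chain survives until time `R` with probability at most `E[X^{(0)}] * 4 / (R + 4)`. -/
lemma IsPoissonChain.one_le_measure_extinct_add {n : ℕ} {q : ℝ} {Ω : Type*} [MeasurableSpace Ω]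
    {P : Measure Ω} [IsProbabilityMeasure P] {X : Ω → ℕ → ℕ} (hX : IsPoissonChain n q P X) :
    1 ≤ P {ω | X ω (RparU n q) = 0}
      + ENNReal.ofReal (4 / (RparU n q + 4)) * ∑' v : ℕ, (v : ℝ≥0∞) * P {ω | X ω 0 = v} := by
  have hext := hX.lintegral_extinction 0 (RparU n q) (by omega)
  rw [zero_add] at hext
  rw [← hext, ← lintegral_comp_nat P (hX.1 0) fun v => (v : ℝ≥0∞)]
  have hm (f : ℕ → ℝ≥0∞) : Measurable fun ω => f (X ω 0) :=
    (measurable_of_countable f).comp (hX.1 0)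
  rw [← lintegral_const_mul _ (hm fun v => (v : ℝ≥0∞)),
    ← lintegral_add_left (hm fun j => ENNReal.ofReal (poissonExtinctionProb _ ^ j))]
  calc (1 : ℝ≥0∞) = ∫⁻ _, 1 ∂P := by simp
    _ ≤ _ := lintegral_mono fun ω => ?_
  obtain ⟨h0, h1⟩ := one_sub_poissonExtinctionProb_mem (RparU n q)
  have hs := poissonExtinctionProb_nonneg (RparU n q)
  have hb := one_add_mul_le_pow (a := poissonExtinctionProb (RparU n q) - 1) (by linarith) (X ω 0)
  rw [add_sub_cancel] at hb
  have hx := mul_le_mul_of_nonneg_right h1 (Nat.cast_nonneg (α := ℝ) (X ω 0))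
  rw [← ENNReal.ofReal_natCast, ← ENNReal.ofReal_mul (by positivity),
    ← ENNReal.ofReal_add (by positivity) (by positivity), ENNReal.one_le_ofReal]
  linarith

lemma tendsto_rpow_div_RparU_add_four {q : ℝ} (hq : q < 1 / 3) (C : ℝ) (hC : 0 ≤ C) :
    Tendsto (fun n : ℕ => 4 / ((RparU n q : ℝ) + 4) * (C * (n : ℝ) ^ q)) atTop (𝓝 0) := by
  have hlog : Tendsto (fun x : ℝ => Real.log x ^ 3 / x ^ (1 - 3 * q)) atTop (𝓝 0) := by
    have h := (isLittleO_log_rpow_rpow_atTop (s := 1 - 3 * q) 3 (by linarith)).tendsto_div_nhds_zero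
    exact h.congr fun x => by norm_cast
  have hlim : Tendsto (fun n : ℕ => 4 * C * (Real.log n ^ 3 / (n : ℝ) ^ (1 - 3 * q)))
      atTop (𝓝 0) := by
    simpa using (hlog.comp tendsto_natCast_atTop_atTop).const_mul (4 * C)
  refine squeeze_zero' (.of_forall fun n => by positivity) ?_ hlim
  filter_upwards [eventually_ge_atTop 2] with n hn
  have hn1 : (1 : ℝ) < n := by exact_mod_cast hn
  have hn0 : (0 : ℝ) < n := by linarith
  have hL : 0 < Real.log n := Real.log_pos hn1
  have hR : (n : ℝ) ^ (1 - 2 * q) / Real.log n ^ 3 ≤ (RparU n q : ℝ) + 4 := by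
    have := (Nat.lt_floor_add_one ((n : ℝ) ^ (1 - 2 * q) / Real.log n ^ 3)).le
    unfold RparU
    linarith
  have hpos : 0 < (n : ℝ) ^ (1 - 2 * q) / Real.log n ^ 3 := by positivity
  calc 4 / ((RparU n q : ℝ) + 4) * (C * (n : ℝ) ^ q)
      ≤ 4 / ((n : ℝ) ^ (1 - 2 * q) / Real.log n ^ 3) * (C * (n : ℝ) ^ q) := by gcongr
    _ = 4 * C * (Real.log n ^ 3 / (n : ℝ) ^ (1 - 3 * q)) := by
      have : (n : ℝ) ^ (1 - 2 * q) = (n : ℝ) ^ (1 - 3 * q) * (n : ℝ) ^ q := by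
        rw [← Real.rpow_add hn0]; ring_nf
      rw [this]
      field_simp

/-- a Galton–Watson branching process with `Poisson(1)` offspring distribution
started from `X^{(0)}` with `E[X^{(0)}] ≤ C₀ n^q` (`0 < q < 1/3`) dies out before time
`R = ⌊n^{1−2q}/log³ n⌋` with probability tending to one. -/
theorem statement19 (q : ℝ) (hq0 : 0 < q) (hq : q < 1 / 3)
    (C₀ : ℝ) (hC₀ : 0 < C₀)
    (Ω : ℕ → Type*) [∀ n, MeasurableSpace (Ω n)]
    (P : ∀ n, Measure (Ω n)) [∀ n, IsProbabilityMeasure (P n)]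
    (X : ∀ n, Ω n → ℕ → ℕ)
    (hchain : ∀ n, IsPoissonChain n q (P n) (X n))
    (hEX0 : ∀ n, (∑' v : ℕ, (v : ℝ≥0∞) * (P n) {ω | X n ω 0 = v})
      ≤ ENNReal.ofReal (C₀ * (n : ℝ) ^ q)) :
    Tendsto (fun n => ((P n) {ω | X n ω (RparU n q) = 0}).toReal) atTop (𝓝 1) := by
  have hlow (n : ℕ) : 1 - 4 / ((RparU n q : ℝ) + 4) * (C₀ * (n : ℝ) ^ q)
      ≤ ((P n) {ω | X n ω (RparU n q) = 0}).toReal := by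
    have h := (hchain n).one_le_measure_extinct_add.trans
      (add_le_add_right (mul_le_mul_right (hEX0 n) _) _)
    rw [← ENNReal.ofReal_mul (by positivity), ← ENNReal.ofReal_toReal (measure_ne_top (P n) _),
      ← ENNReal.ofReal_add ENNReal.toReal_nonneg (by positivity), ENNReal.one_le_ofReal] at h
    linarith
  have hlim := (tendsto_rpow_div_RparU_add_four hq C₀ hC₀.le).const_sub 1
  rw [sub_zero] at hlim
  exact tendsto_of_tendsto_of_tendsto_of_le_of_le hlim tendsto_const_nhds hlow
    fun n => measureReal_le_one
end
end
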